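/- The lattice D has rank (m+q)n − n² + 2, i.e. every maximal chain in D has cardinality (m+q)n − n² + 3. -/

import Mathlib

namespace SMB

/-- `geTup f g` : the strictly increasing tuple `f` is `≥` the strictly increasing tuple `g`
in the order on increasing tuples: the length of `f` is at most that of `g`, and `f` is
entrywise `≥` `g` (on the common range of indices). -/
def geTup {N s s' : ℕ} (f : Fin s → Fin N) (g : Fin s' → Fin N) : Prop :=
  ∃ h : s ≤ s', ∀ j : Fin s, g (Fin.castLE h j) ≤ f j

/-- A strictly increasing `s`-tuple with values in `{1,…,N}` (encoded as `Fin N`). -/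
structure IncTup (s N : ℕ) where
  f : Fin s → Fin N
  mono : StrictMono f

/-- A pair of strictly increasing tuples of a common length `s`: row indices in `{1,…,m}`
and column indices in `{1,…,q}`, indexing an `s × s` minor. -/
structure PairIx (m q : ℕ) where
  s : ℕ
  rows : Fin s → Fin m
  cols : Fin s → Fin q
  rmono : StrictMono rows
  cmono : StrictMono cols

/-- The partial order `(A,B) ⪰ (A',B')` on pairs of increasing tuples: `A ≥ A'` and `B ≥ B'`. -/
def PairIx.ge {m q : ℕ} (x y : PairIx m q) : Prop :=
  geTup x.rows y.rows ∧ geTup x.cols y.cols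

end SMB
namespace SMB

variable (n m q : ℕ)

/-- The index set `H = H_u ⊔ H_ξ ⊔ H_p`, where `H_u = I(n,m)`, `H_ξ = I(n,q)` and
`H_p = ⋃_{1 ≤ r ≤ n} I(r,m) × I(r,q)`. -/
abbrev HElt := IncTup n m ⊕ (IncTup n q ⊕ {x : PairIx m q // 0 < x.s ∧ x.s ≤ n})

variable {n m q}

/-- The partial order on `H`: componentwise order on `H_u` and on `H_ξ`; the order `⪰` on
`H_p`; elements of `H_u` and `H_ξ` mutually incomparable; no element of `H_u ∪ H_ξ` above
any element of `H_p`; `I ≤ (A,B)` iff `I ≤ A`, and `J ≤ (A,B)` iff `J ≤ B`. -/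
def hle : HElt n m q → HElt n m q → Prop
  | Sum.inl I, Sum.inl I' => ∀ j, I.f j ≤ I'.f j
  | Sum.inl I, Sum.inr (Sum.inr P) => geTup P.val.rows I.f
  | Sum.inr (Sum.inl J), Sum.inr (Sum.inl J') => ∀ j, J.f j ≤ J'.f j
  | Sum.inr (Sum.inl J), Sum.inr (Sum.inr P) => geTup P.val.cols J.f
  | Sum.inr (Sum.inr P), Sum.inr (Sum.inr P') => PairIx.ge P'.val P.val
  | _, _ => False

end SMB
namespace SMB

variable (n m q : ℕ)

/-- The poset `D = H ∪ {1̂} ∪ {0̂}`, obtained from `H` by adjoining a largest element `1̂`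
and a smallest element `0̂`. -/
inductive DElt (n m q : ℕ) where
  | bot : DElt n m q
  | top : DElt n m q
  | of : HElt n m q → DElt n m q

variable {n m q}

/-- The partial order on `D`: `0̂` is smallest, `1̂` is largest, and `D` restricts to the
order on `H`. -/
def dle : DElt n m q → DElt n m q → Prop
  | DElt.bot, _ => True
  | _, DElt.top => True
  | DElt.of x, DElt.of y => hle x y
  | _, _ => False

end SMB

namespace SMB

/-- In a bounded poset where every strict inequality `x < y` can be refined by an element
`z ∈ (x, y]` of rank one more than `x`, all maximal finite chains have the same cardinality. -/
theorem rank_bot_add_card_of_maximal_chain {α : Type*} [PartialOrder α] [BoundedOrder α]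
    (ρ : α → ℕ)
    (step : ∀ x y : α, x < y → ∃ z, x ≤ z ∧ z ≤ y ∧ ρ z = ρ x + 1)
    (C : Finset α) (hC : IsChain (· ≤ ·) (C : Set α))
    (hmax : ∀ C' : Finset α, IsChain (· ≤ ·) (C' : Set α) → C ⊆ C' → C' = C) :
    ρ ⊥ + C.card = ρ ⊤ + 1 := by
  classical
  have mem_of_comparable : ∀ z, (∀ w ∈ C, z ≤ w ∨ w ≤ z) → z ∈ C := by
    intro z hz
    have h := hmax (insert z C) (by
      rw [Finset.coe_insert]
      exact hC.insert fun w hw _ => hz w hw) (Finset.subset_insert _ _)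
    rw [← h]
    exact Finset.mem_insert_self _ _
  have top_mem : (⊤ : α) ∈ C := mem_of_comparable _ fun _ _ => Or.inr le_top
  have bot_mem : (⊥ : α) ∈ C := mem_of_comparable _ fun _ _ => Or.inl bot_le
  have card_above : ∀ k, ∀ x ∈ C, (C.filter (x < ·)).card = k → ρ x + k = ρ ⊤ := by
    intro k
    induction k with
    | zero =>
      intro x _ hk
      rw [Finset.card_eq_zero, Finset.filter_eq_empty_iff] at hk
      rw [not_lt_top_iff.mp (hk top_mem), add_zero]
    | succ k ih =>
      intro x hx hk
      obtain ⟨y, hy⟩ := (C.filter (x < ·)).exists_minimal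
        (Finset.card_pos.mp (by omega))
      obtain ⟨hyC, hxy⟩ := Finset.mem_filter.mp hy.prop
      have le_or_le : ∀ w ∈ C, w ≤ x ∨ y ≤ w := by
        intro w hw
        rcases hC.total hw hx with h | h
        · exact Or.inl h
        · rcases h.eq_or_lt with rfl | h
          · exact Or.inl le_rfl
          · rcases hC.total hw hyC with h' | h'
            · exact Or.inr (hy.le_of_le (Finset.mem_filter.mpr ⟨hw, h⟩) h')
            · exact Or.inr h'
      obtain ⟨z, hxz, hzy, hz⟩ := step x y hxy
      have hzC : z ∈ C := mem_of_comparable z fun w hw =>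
        (le_or_le w hw).symm.imp hzy.trans fun h => h.trans hxz
      have hyz : z = y := by
        rcases le_or_le z hzC with h | h
        · rw [le_antisymm h hxz] at hz
          omega
        · exact le_antisymm hzy h
      subst hyz
      have hfilter : C.filter (x < ·) = insert z (C.filter (z < ·)) := by
        ext w
        simp only [Finset.mem_filter, Finset.mem_insert]
        constructor
        · rintro ⟨hw, hxw⟩
          rcases le_or_le w hw with h | h
          · exact absurd h hxw.not_ge
          · exact h.eq_or_lt.imp Eq.symm fun h => ⟨hw, h⟩
        · rintro (rfl | ⟨hw, h⟩)
          · exact ⟨hzC, hxy⟩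
          · exact ⟨hw, hxy.trans h⟩
      rw [hfilter, Finset.card_insert_of_notMem (by simp)] at hk
      have := ih z hzC (by omega)
      omega
  have hfilter : C = insert ⊥ (C.filter (⊥ < ·)) := by
    ext w
    simp only [Finset.mem_filter, Finset.mem_insert, bot_lt_iff_ne_bot]
    constructor
    · intro hw
      exact (eq_or_ne w ⊥).imp id fun h => ⟨hw, h⟩
    · rintro (rfl | h)
      exacts [bot_mem, h.1]
  have hcard := congrArg Finset.card hfilter
  rw [Finset.card_insert_of_notMem (by simp)] at hcard
  have := card_above _ ⊥ bot_mem rfl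
  omega

theorem geTup_refl {N s : ℕ} (f : Fin s → Fin N) : geTup f f :=
  ⟨le_rfl, fun _ => le_rfl⟩

theorem geTup.trans {N s s' s'' : ℕ} {f : Fin s → Fin N} {g : Fin s' → Fin N}
    {h : Fin s'' → Fin N} (hfg : geTup f g) (hgh : geTup g h) : geTup f h := by
  obtain ⟨h₁, hfg⟩ := hfg
  obtain ⟨h₂, hgh⟩ := hgh
  exact ⟨h₁.trans h₂, fun j => (hgh (Fin.castLE h₁ j)).trans (hfg j)⟩

theorem geTup_iff_of_same_length {N s : ℕ} {f g : Fin s → Fin N} :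
    geTup f g ↔ ∀ j, g j ≤ f j :=
  ⟨fun ⟨_, h⟩ => h, fun h => ⟨le_rfl, h⟩⟩

theorem IncTup.ext_of_le {s N : ℕ} {I J : IncTup s N} (h₁ : ∀ j, I.f j ≤ J.f j)
    (h₂ : ∀ j, J.f j ≤ I.f j) : I = J := by
  cases I
  cases J
  congr
  exact funext fun j => le_antisymm (h₁ j) (h₂ j)

theorem PairIx.ge_antisymm {m q : ℕ} {x y : PairIx m q} (h₁ : x.ge y) (h₂ : y.ge x) :
    x = y := by
  obtain ⟨s, a, b, _, _⟩ := x
  obtain ⟨s', a', b', _, _⟩ := y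
  obtain rfl : s = s' := le_antisymm h₁.1.1 h₂.1.1
  congr
  · exact funext fun j => le_antisymm (h₂.1.2 j) (h₁.1.2 j)
  · exact funext fun j => le_antisymm (h₂.2.2 j) (h₁.2.2 j)

variable {n m q : ℕ}

theorem hle_refl : ∀ x : HElt n m q, hle x x
  | Sum.inl _ => fun _ => le_rfl
  | Sum.inr (Sum.inl _) => fun _ => le_rfl
  | Sum.inr (Sum.inr _) => ⟨geTup_refl _, geTup_refl _⟩

theorem hle_trans : ∀ {x y z : HElt n m q}, hle x y → hle y z → hle x z := by
  rintro (I | I | P) (J | J | Q) (K | K | R) h₁ h₂ <;>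
    first
    | exact h₁.elim
    | exact h₂.elim
    | exact fun j => (h₁ j).trans (h₂ j)
    | exact geTup.trans h₂ (geTup_iff_of_same_length.mpr h₁)
    | exact geTup.trans h₂.1 h₁
    | exact geTup.trans h₂.2 h₁
    | exact ⟨geTup.trans h₂.1 h₁.1, geTup.trans h₂.2 h₁.2⟩

theorem hle_antisymm : ∀ {x y : HElt n m q}, hle x y → hle y x → x = y := by
  rintro (I | I | P) (J | J | Q) h₁ h₂ <;>
    first
    | exact h₁.elim
    | exact h₂.elim
    | rw [IncTup.ext_of_le h₁ h₂]
    | rw [Subtype.ext (PairIx.ge_antisymm h₂ h₁)]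

instance : PartialOrder (DElt n m q) where
  le := dle
  le_refl
    | .bot => trivial
    | .top => trivial
    | .of x => hle_refl x
  le_trans := by
    rintro (_ | _ | x) (_ | _ | y) (_ | _ | z) h₁ h₂ <;>
      first
      | trivial
      | exact h₁.elim
      | exact h₂.elim
      | exact hle_trans h₁ h₂
  le_antisymm := by
    rintro (_ | _ | x) (_ | _ | y) h₁ h₂ <;>
      first
      | rfl
      | exact h₁.elim
      | exact h₂.elim
      | rw [hle_antisymm h₁ h₂]

instance : BoundedOrder (DElt n m q) where
  top := .top
  bot := .bot
  le_top x := by cases x <;> trivial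
  bot_le _ := trivial

/-- The sum of the entries of a tuple. -/
def wt {s N : ℕ} (f : Fin s → Fin N) : ℕ := ∑ j, (f j : ℕ)

/-- The rank function of `D`, up to a constant. -/
def rk : DElt n m q → ℕ
  | .bot => 2 * ∑ j : Fin n, (j : ℕ)
  | .top => n * (m + q - 1) + 2
  | .of (Sum.inl I) => wt I.f + ∑ j : Fin n, (j : ℕ) + 1
  | .of (Sum.inr (Sum.inl J)) => wt J.f + ∑ j : Fin n, (j : ℕ) + 1
  | .of (Sum.inr (Sum.inr P)) =>
      wt P.val.rows + wt P.val.cols + (n - P.val.s) * (m + q - 1) + 2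

theorem exists_increment {s N : ℕ} {f g : Fin s → Fin N} (hf : StrictMono f)
    (hg : StrictMono g) (hle : ∀ j, f j ≤ g j) (hne : f ≠ g) :
    ∃ h : Fin s → Fin N, StrictMono h ∧ (∀ j, f j ≤ h j) ∧ (∀ j, h j ≤ g j) ∧
      wt h = wt f + 1 := by
  have hS : (Finset.univ.filter fun j => f j < g j).Nonempty := by
    obtain ⟨j, hj⟩ := Function.ne_iff.mp hne
    exact ⟨j, by simpa using lt_of_le_of_ne (hle j) hj⟩
  obtain ⟨j, hj⟩ := Finset.exists_maximal hS
  have hjlt : f j < g j := (Finset.mem_filter.mp hj.prop).2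
  have eq_above : ∀ i, j < i → f i = g i := by
    intro i hi
    by_contra h
    have := hj.le_of_ge (Finset.mem_filter.mpr
      ⟨Finset.mem_univ i, lt_of_le_of_ne (hle i) h⟩) hi.le
    exact absurd hi this.not_gt
  have hb : (f j : ℕ) + 1 < N := lt_of_le_of_lt hjlt (g j).2
  refine ⟨Function.update f j ⟨f j + 1, hb⟩, ?_, ?_, ?_, ?_⟩
  · intro i k hik
    rcases eq_or_ne i j with rfl | hi
    · rw [Function.update_self, Function.update_of_ne hik.ne', eq_above k hik]
      exact lt_of_le_of_lt (Fin.mk_le_of_le_val hjlt) (hg hik)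
    · rw [Function.update_of_ne hi]
      rcases eq_or_ne k j with rfl | hk
      · rw [Function.update_self]
        exact Nat.lt_succ_of_lt (hf hik)
      · rw [Function.update_of_ne hk]
        exact hf hik
  · intro i
    rcases eq_or_ne i j with rfl | hi
    · rw [Function.update_self]
      exact Nat.le_succ _
    · rw [Function.update_of_ne hi]
  · intro i
    rcases eq_or_ne i j with rfl | hi
    · rw [Function.update_self]
      exact Fin.mk_le_of_le_val hjlt
    · rw [Function.update_of_ne hi]
      exact hle i
  · unfold wt
    rw [← Finset.add_sum_erase _ _ (Finset.mem_univ j),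
      ← Finset.add_sum_erase (a := j) _ (fun i => (f i : ℕ)) (Finset.mem_univ j),
      Function.update_self]
    have : ∑ i ∈ Finset.univ.erase j, ((Function.update f j ⟨f j + 1, hb⟩ i : Fin N) : ℕ) =
        ∑ i ∈ Finset.univ.erase j, (f i : ℕ) :=
      Finset.sum_congr rfl fun i hi => by
        rw [Function.update_of_ne (Finset.ne_of_mem_erase hi)]
    rw [this]
    change (f j : ℕ) + 1 + _ = _
    omega

/-- Either the last entry of a tuple is the largest possible one, or it can be increased. -/
theorem last_eq_or_exists_increment {t N : ℕ} {f : Fin (t + 1) → Fin N}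
    (hf : StrictMono f) :
    (f (Fin.last t) : ℕ) + 1 = N ∨
      ∃ h : Fin (t + 1) → Fin N, StrictMono h ∧ (∀ j, f j ≤ h j) ∧
        (∀ j : Fin t, h j.castSucc ≤ f j.castSucc) ∧ wt h = wt f + 1 := by
  have hlt := (f (Fin.last t)).2
  rcases eq_or_ne ((f (Fin.last t) : ℕ) + 1) N with h | h
  · exact Or.inl h
  right
  set g := Function.update f (Fin.last t) ⟨N - 1, by omega⟩ with hgdef
  have hg_cast : ∀ j : Fin t, g j.castSucc = f j.castSucc := fun j =>
    Function.update_of_ne (Fin.castSucc_lt_last j).ne _ _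
  have hg_last : (g (Fin.last t) : ℕ) = N - 1 := by rw [hgdef, Function.update_self]
  have hle : ∀ j, f j ≤ g j := by
    intro j
    induction j using Fin.lastCases with
    | last => rw [Fin.le_def, hg_last]; omega
    | cast j => rw [hg_cast]
  have hg : StrictMono g := by
    intro i k hik
    induction k using Fin.lastCases with
    | last =>
      induction i using Fin.lastCases with
      | last => exact absurd hik (lt_irrefl _)
      | cast i => rw [hg_cast]; exact lt_of_lt_of_le (hf hik) (hle _)
    | cast k =>
      induction i using Fin.lastCases with
      | last => exact absurd hik (Fin.castSucc_lt_last k).not_gt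
      | cast i => rw [hg_cast, hg_cast]; exact hf hik
  obtain ⟨h', h₁, h₂, h₃, h₄⟩ := exists_increment hf hg hle (by
    intro hfg
    rw [← hfg] at hg_last
    omega)
  exact ⟨h', h₁, h₂, fun j => hg_cast j ▸ h₃ j.castSucc, h₄⟩

/-- The tuple `(1, …, n)`. -/
def minTup {n N : ℕ} (h : n ≤ N) : IncTup n N := ⟨Fin.castLE h, Fin.strictMono_castLE h⟩

theorem wt_minTup {n N : ℕ} (h : n ≤ N) : wt (minTup h).f = ∑ j : Fin n, (j : ℕ) := rfl

theorem val_le_of_strictMono {s N : ℕ} {f : Fin s → Fin N} (hf : StrictMono f) (j : Fin s) :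
    (j : ℕ) ≤ f j := by
  obtain ⟨k, hk⟩ := j
  induction k with
  | zero => exact Nat.zero_le _
  | succ k ih =>
    have h := ih (by omega)
    have : f ⟨k, by omega⟩ < f ⟨k + 1, hk⟩ := hf (by simp [Fin.lt_def])
    exact lt_of_le_of_lt h this

theorem geTup_minTup {s n N : ℕ} (h : n ≤ N) {f : Fin s → Fin N} (hf : StrictMono f)
    (hs : s ≤ n) : geTup f (minTup h).f :=
  ⟨hs, fun j => val_le_of_strictMono hf j⟩

theorem PairIx.exists_step (x y : {x : PairIx m q // 0 < x.s ∧ x.s ≤ n})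
    (hle : y.val.ge x.val) (hne : x ≠ y) :
    ∃ z : {x : PairIx m q // 0 < x.s ∧ x.s ≤ n}, z.val.ge x.val ∧ y.val.ge z.val ∧
      rk (.of (.inr (.inr z)) : DElt n m q) = rk (.of (.inr (.inr x)) : DElt n m q) + 1 := by
  obtain ⟨⟨s, a, b, ha, hb⟩, hs⟩ := x
  obtain ⟨⟨s', a', b', ha', hb'⟩, hs'⟩ := y
  obtain ⟨hss, haa⟩ : geTup a' a := hle.1
  obtain ⟨_, hbb⟩ : geTup b' b := hle.2
  have hpos : 0 < s' := hs'.1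
  have hsn : s ≤ n := hs.2
  rcases hss.eq_or_lt with rfl | hlt
  · rcases eq_or_ne a a' with rfl | hane
    · rcases eq_or_ne b b' with rfl | hbne
      · exact absurd rfl hne
      · obtain ⟨h, h₁, h₂, h₃, h₄⟩ := exists_increment hb hb' hbb hbne
        refine ⟨⟨⟨s', a, h, ha, h₁⟩, hs⟩, ⟨geTup_refl _, le_rfl, h₂⟩,
          ⟨geTup_refl _, le_rfl, h₃⟩, ?_⟩
        simp only [rk]
        omega
    · obtain ⟨h, h₁, h₂, h₃, h₄⟩ := exists_increment ha ha' haa hane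
      refine ⟨⟨⟨s', h, b, h₁, hb⟩, hs⟩, ⟨⟨le_rfl, h₂⟩, geTup_refl _⟩,
        ⟨⟨le_rfl, h₃⟩, ⟨le_rfl, hbb⟩⟩, ?_⟩
      simp only [rk]
      omega
  · obtain ⟨t, rfl⟩ : ∃ t, s = t + 1 := ⟨s - 1, by omega⟩
    have hst : s' ≤ t := by omega
    rcases last_eq_or_exists_increment ha with hal | ⟨h, h₁, h₂, h₃, h₄⟩
    · rcases last_eq_or_exists_increment hb with hbl | ⟨h, h₁, h₂, h₃, h₄⟩
      · refine ⟨⟨⟨t, a ∘ Fin.castSucc, b ∘ Fin.castSucc, ha.comp Fin.strictMono_castSucc,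
          hb.comp Fin.strictMono_castSucc⟩, show 0 < t by omega, show t ≤ n by omega⟩,
          ⟨⟨Nat.le_succ t, fun _ => le_rfl⟩, ⟨Nat.le_succ t, fun _ => le_rfl⟩⟩,
          ⟨⟨hst, haa⟩, ⟨hst, hbb⟩⟩, ?_⟩
        simp only [rk, wt, Fin.sum_univ_castSucc, Function.comp_apply]
        obtain ⟨d, hd⟩ : ∃ d, n = t + 1 + d := ⟨n - (t + 1), by omega⟩
        rw [show n - t = d + 1 by omega, show n - (t + 1) = d by omega, Nat.add_mul]
        omega
      · refine ⟨⟨⟨t + 1, a, h, ha, h₁⟩, hs⟩, ⟨geTup_refl _, le_rfl, h₂⟩,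
          ⟨⟨hss, haa⟩, ⟨hss, fun j => (h₃ (Fin.castLE hst j)).trans (hbb j)⟩⟩, ?_⟩
        simp only [rk]
        omega
    · refine ⟨⟨⟨t + 1, h, b, h₁, hb⟩, hs⟩, ⟨⟨le_rfl, h₂⟩, geTup_refl _⟩,
        ⟨⟨hss, fun j => (h₃ (Fin.castLE hst j)).trans (haa j)⟩, ⟨hss, hbb⟩⟩, ?_⟩
      simp only [rk]
      omega

/-- The largest element of `H`, the pair of one-term tuples `((m), (q))`. -/
def maxPair (hn : 0 < n) (hm : n < m) (hq : n < q) :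
    {x : PairIx m q // 0 < x.s ∧ x.s ≤ n} :=
  ⟨⟨1, fun _ => ⟨m - 1, by omega⟩, fun _ => ⟨q - 1, by omega⟩,
    Subsingleton.strictMono _, Subsingleton.strictMono _⟩, Nat.one_pos, hn⟩

theorem hle_maxPair (hn : 0 < n) (hm : n < m) (hq : n < q) (x : HElt n m q) :
    hle x (.inr (.inr (maxPair hn hm hq))) := by
  have le_pred : ∀ {N : ℕ} (a : Fin N) (h : N - 1 < N), a ≤ ⟨N - 1, h⟩ :=
    fun a _ => Nat.le_sub_one_of_lt a.2
  rcases x with I | J | P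
  · exact ⟨hn, fun _ => le_pred _ _⟩
  · exact ⟨hn, fun _ => le_pred _ _⟩
  · exact ⟨⟨P.2.1, fun _ => le_pred _ _⟩, ⟨P.2.1, fun _ => le_pred _ _⟩⟩

theorem rk_maxPair (hn : 0 < n) (hm : n < m) (hq : n < q) :
    rk (.top : DElt n m q) =
      rk (.of (.inr (.inr (maxPair hn hm hq))) : DElt n m q) + 1 := by
  obtain ⟨d, rfl⟩ : ∃ d, n = d + 1 := ⟨n - 1, by omega⟩
  have hrows : wt (maxPair hn hm hq).val.rows = m - 1 :=
    Fin.sum_univ_one fun _ => m - 1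
  have hcols : wt (maxPair hn hm hq).val.cols = q - 1 :=
    Fin.sum_univ_one fun _ => q - 1
  change (d + 1) * (m + q - 1) + 2 = wt (maxPair hn hm hq).val.rows +
    wt (maxPair hn hm hq).val.cols + d * (m + q - 1) + 2 + 1
  rw [hrows, hcols, Nat.add_mul]
  omega

theorem exists_step_of (hm : n < m) (hq : n < q) (x y : HElt n m q)
    (hle : hle x y) (hne : x ≠ y) :
    ∃ z, SMB.hle x z ∧ SMB.hle z y ∧
      rk (.of z : DElt n m q) = rk (.of x : DElt n m q) + 1 := by
  rcases x with I | I | P <;> rcases y with J | J | Q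
  · obtain ⟨h, h₁, h₂, h₃, h₄⟩ := exists_increment I.mono J.mono hle fun h =>
      hne (congrArg _ (IncTup.ext_of_le (fun j => (congrFun h j).le)
        fun j => (congrFun h j).ge))
    refine ⟨.inl ⟨h, h₁⟩, h₂, h₃, ?_⟩
    simp only [rk]
    omega
  · exact hle.elim
  · refine ⟨.inr (.inr ⟨⟨n, I.f, (minTup hq.le).f, I.mono, (minTup hq.le).mono⟩,
      Nat.lt_of_lt_of_le Q.2.1 Q.2.2, le_rfl⟩), geTup_refl _,
      ⟨hle, geTup_minTup hq.le Q.val.cmono Q.2.2⟩, ?_⟩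
    simp only [rk, wt_minTup, Nat.sub_self, Nat.zero_mul, Nat.add_zero]
  · exact hle.elim
  · obtain ⟨h, h₁, h₂, h₃, h₄⟩ := exists_increment I.mono J.mono hle fun h =>
      hne (congrArg _ (congrArg _ (IncTup.ext_of_le (fun j => (congrFun h j).le)
        fun j => (congrFun h j).ge)))
    refine ⟨.inr (.inl ⟨h, h₁⟩), h₂, h₃, ?_⟩
    simp only [rk]
    omega
  · refine ⟨.inr (.inr ⟨⟨n, (minTup hm.le).f, I.f, (minTup hm.le).mono, I.mono⟩,
      Nat.lt_of_lt_of_le Q.2.1 Q.2.2, le_rfl⟩), geTup_refl _,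
      ⟨geTup_minTup hm.le Q.val.rmono Q.2.2, hle⟩, ?_⟩
    simp only [rk, wt_minTup, Nat.sub_self, Nat.zero_mul, Nat.add_zero]
    omega
  · exact hle.elim
  · exact hle.elim
  · obtain ⟨z, h₁, h₂, h₃⟩ := PairIx.exists_step P Q hle fun h => hne (by rw [h])
    exact ⟨.inr (.inr z), h₁, h₂, h₃⟩

theorem exists_step_bot (hm : n < m) (hq : n < q) (y : HElt n m q) :
    ∃ z, hle z y ∧ rk (.of z : DElt n m q) = rk (.bot : DElt n m q) + 1 := by
  rcases y with J | J | Q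
  · refine ⟨.inl (minTup hm.le), fun j => val_le_of_strictMono J.mono j, ?_⟩
    simp only [rk, wt_minTup]
    omega
  · refine ⟨.inr (.inl (minTup hq.le)), fun j => val_le_of_strictMono J.mono j, ?_⟩
    simp only [rk, wt_minTup]
    omega
  · refine ⟨.inl (minTup hm.le), geTup_minTup _ Q.val.rmono Q.2.2, ?_⟩
    simp only [rk, wt_minTup]
    omega

theorem exists_step (hn : 0 < n) (hm : n < m) (hq : n < q) (x y : DElt n m q)
    (hxy : x < y) : ∃ z, x ≤ z ∧ z ≤ y ∧ rk z = rk x + 1 := by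
  rcases x with _ | _ | x
  · rcases y with _ | _ | y
    · exact absurd hxy (lt_irrefl _)
    · obtain ⟨z, _, hz⟩ := exists_step_bot hm hq (.inr (.inr (maxPair hn hm hq)))
      exact ⟨.of z, bot_le, le_top, hz⟩
    · obtain ⟨z, hzy, hz⟩ := exists_step_bot hm hq y
      exact ⟨.of z, bot_le, hzy, hz⟩
  · exact absurd hxy not_top_lt
  · rcases y with _ | _ | y
    · exact absurd hxy not_lt_bot
    · by_cases h : x = .inr (.inr (maxPair hn hm hq))
      · subst h
        exact ⟨.top, le_top, le_rfl, rk_maxPair hn hm hq⟩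
      · obtain ⟨z, h₁, _, hz⟩ := exists_step_of hm hq x _ (hle_maxPair hn hm hq x) h
        exact ⟨.of z, h₁, le_top, hz⟩
    · obtain ⟨z, h₁, h₂, hz⟩ := exists_step_of hm hq x y hxy.le fun h =>
        hxy.ne (congrArg _ h)
      exact ⟨.of z, h₁, h₂, hz⟩

end SMB

open SMB in
/-- **`D` is ranked of rank `(m+q)n − n² + 2`.**
Every maximal chain in the lattice `D = H ∪ {1̂, 0̂}` has cardinality `(m+q)n − n² + 3`. -/
theorem D_is_ranked (n m q : ℕ) (hn : 0 < n) (hm : n < m) (hq : n < q)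
    (C : Finset (DElt n m q)) (hC : IsChain dle (C : Set (DElt n m q)))
    (hmax : ∀ C' : Finset (DElt n m q),
      IsChain dle (C' : Set (DElt n m q)) → C ⊆ C' → C' = C) :
    C.card = (m + q) * n - n ^ 2 + 3 := by
  have h := rank_bot_add_card_of_maximal_chain rk (exists_step hn hm hq) C hC hmax
  change 2 * ∑ j : Fin n, (j : ℕ) + C.card = n * (m + q - 1) + 2 + 1 at h
  rw [Fin.sum_univ_eq_sum_range (fun j => j) n, mul_comm 2, Finset.sum_range_id_mul_two] at h
  obtain ⟨k, rfl⟩ := Nat.exists_eq_add_of_lt hn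
  obtain ⟨d, rfl⟩ := Nat.exists_eq_add_of_lt hm
  rw [show 0 + k + 1 - 1 = k by omega,
    show 0 + k + 1 + d + 1 + q - 1 = k + d + 1 + q by omega] at h
  rw [show (0 + k + 1 + d + 1 + q) * (0 + k + 1) =
    (d + 1 + q) * (k + 1) + (0 + k + 1) ^ 2 by ring, Nat.add_sub_cancel]
  linarith
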